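/- Let N ≥ 0 and γ, δ ∈ ℝ, and let ℛ_{N+1}(γ,δ) be the (N+1)×(N+1) real tridiagonal matrix (indexed 0,…,N) with diagonal entries (ℛ)_{n,n} = N(γ+2n+1) − n(γ−δ+2n), superdiagonal entries (ℛ)_{n,n+1} = (N−n)(γ+n+1), and subdiagonal entries (ℛ)_{n,n−1} = n(N+δ+1−n). Set λ(t) = −t(t+γ+δ+1). Then for every real x, det(λ(x)·I_{N+1} + ℛ_{N+1}(γ,δ)) = ∏_{n=0}^{N} (λ(x) − λ(n)) = ∏_{n=0}^{N} (n − x)(x + n + γ + δ + 1); in shifted-factorial notation the determinant equals (−x)_{N+1}(x+γ+δ+1)_{N+1}. -/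

import Mathlib

/-- The dual Hahn matrix `ℛ_{N+1}(γ, δ)`: diagonal entries `N(γ + 2n + 1) - n(γ - δ + 2n)`,
superdiagonal entries `(N - n)(γ + n + 1)`, subdiagonal entries `n(N + δ + 1 - n)`
(0-indexed, size `N + 1`). -/
def dualHahnR (N : ℕ) (γ δ : ℝ) : Matrix (Fin (N + 1)) (Fin (N + 1)) ℝ :=
  Matrix.of fun i j =>
    if (j : ℕ) = (i : ℕ) + 1 then ((N : ℝ) - (i : ℕ)) * (γ + (i : ℕ) + 1)
    else if (i : ℕ) = (j : ℕ) + 1 then ((i : ℕ) : ℝ) * ((N : ℝ) + δ + 1 - (i : ℕ))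
    else if i = j then (N : ℝ) * (γ + 2 * (i : ℕ) + 1) - ((i : ℕ) : ℝ) * (γ - δ + 2 * (i : ℕ))
    else 0

/-- The alternating binomial matrix `(-1) ^ n * n.choose k`; its columns triangularize
`dualHahnR`. -/
def signedChoose (n k : ℕ) : ℝ := (-1) ^ n * (n.choose k : ℝ)

theorem signedChoose_succ_zero (n : ℕ) : signedChoose (n + 1) 0 = -signedChoose n 0 := by
  simp [signedChoose, pow_succ]

theorem signedChoose_succ_succ (n k : ℕ) :
    signedChoose (n + 1) (k + 1) = -(signedChoose n k + signedChoose n (k + 1)) := by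
  simp only [signedChoose, Nat.choose_succ_succ, pow_succ, Nat.cast_add, Nat.succ_eq_add_one]
  ring

theorem signedChoose_succ_right (n k : ℕ) :
    signedChoose n (k + 1) * (k + 1) = signedChoose n k * (n - k) := by
  have h : (n.choose (k + 1) : ℝ) * (k + 1) = n.choose k * (n - k) := by
    rcases le_or_gt k n with hk | hk
    · have := Nat.choose_succ_right_eq n k
      rw [← Nat.cast_sub hk]
      exact_mod_cast this
    · simp [Nat.choose_eq_zero_of_lt hk, Nat.choose_eq_zero_of_lt (Nat.lt_succ_of_lt hk)]
  simp only [signedChoose]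
  linear_combination (-1) ^ n * h

theorem mul_signedChoose_pred (n k : ℕ) :
    n * signedChoose (n - 1) k = -(n - k) * signedChoose n k := by
  rcases n with _ | m
  · rcases k with _ | k <;> simp [signedChoose]
  · rcases k with _ | k
    · simp only [signedChoose, pow_succ, Nat.choose_zero_right, Nat.add_sub_cancel]
      push_cast
      ring
    · have h1 := signedChoose_succ_succ m k
      have h2 := signedChoose_succ_right m k
      push_cast [Nat.add_sub_cancel]
      linear_combination (m - k : ℝ) * h1 + h2

/-- A tridiagonal row of `dualHahnR` applied to a sequence; the coefficients vanish where the
sequence would be read outside `0, …, N`. -/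
theorem sum_dualHahnR_mul (N : ℕ) (γ δ : ℝ) (n : Fin (N + 1)) (f : ℕ → ℝ) :
    ∑ j, dualHahnR N γ δ n j * f j =
      (N - (n : ℕ)) * (γ + (n : ℕ) + 1) * f (n + 1) +
        (N + δ + 1 - (n : ℕ)) * ((n : ℕ) * f (n - 1)) +
        (N * (γ + 2 * (n : ℕ) + 1) - (n : ℕ) * (γ - δ + 2 * (n : ℕ))) * f n := by
  obtain ⟨n, hn⟩ := n
  have hsplit : ∀ j : Fin (N + 1), dualHahnR N γ δ ⟨n, hn⟩ j * f j =
      (if (j : ℕ) = n + 1 then (N - n) * (γ + n + 1) * f (n + 1) else 0) +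
      (if (j : ℕ) + 1 = n then (N + δ + 1 - n) * (n * f (n - 1)) else 0) +
      (if (j : ℕ) = n then (N * (γ + 2 * n + 1) - n * (γ - δ + 2 * n)) * f n else 0) := by
    rintro ⟨j, hj⟩
    simp only [dualHahnR, Matrix.of_apply, Fin.mk.injEq]
    rcases lt_trichotomy j n with h | rfl | h
    · by_cases h' : j + 1 = n
      · subst h'
        simp [show j ≠ j + 1 + 1 by omega]
        ring
      · simp [h', show j ≠ n + 1 by omega, show n ≠ j + 1 by omega, h.ne, h.ne']
    · simp
    · by_cases h' : j = n + 1
      · subst h'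
        simp [show n + 1 + 1 ≠ n by omega]
      · simp [h', show j + 1 ≠ n by omega, show n ≠ j + 1 by omega, h.ne, h.ne']
  rw [Finset.sum_congr rfl fun j _ => hsplit j, Finset.sum_add_distrib, Finset.sum_add_distrib]
  congr 1
  · congr 1
    · rw [Fin.sum_univ_eq_sum_range
        (fun j => if j = n + 1 then ((N : ℝ) - n) * (γ + n + 1) * f (n + 1) else 0),
        Finset.sum_ite_eq']
      split_ifs with h
      · rfl
      · obtain rfl : n = N := by
          rw [Finset.mem_range] at h
          omega
        simp
    · rcases n with _ | m
      · simp
      · simp only [Nat.add_right_cancel_iff]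
        rw [Fin.sum_univ_eq_sum_range (fun j => if j = m then
          ((N : ℝ) + δ + 1 - (m + 1 : ℕ)) * ((m + 1 : ℕ) * f (m + 1 - 1)) else 0),
          Finset.sum_ite_eq', if_pos (Finset.mem_range.2 (by omega))]
  · rw [Fin.sum_univ_eq_sum_range (fun j => if j = n then
      ((N : ℝ) * (γ + 2 * n + 1) - n * (γ - δ + 2 * n)) * f n else 0),
      Finset.sum_ite_eq', if_pos (Finset.mem_range.2 hn)]

/-- The upper bidiagonal matrix of `dualHahnR` in the basis `signedChoose`. -/
def dualHahnT (N : ℕ) (γ δ : ℝ) : Matrix (Fin (N + 1)) (Fin (N + 1)) ℝ :=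
  Matrix.of fun i j =>
    if (i : ℕ) = j then (j : ℕ) * ((j : ℕ) + γ + δ + 1)
    else if (i : ℕ) + 1 = j then -((N - (i : ℕ)) * (γ + (i : ℕ) + 1))
    else 0

/-- The matrix whose entries are `signedChoose`. -/
def signedChooseMatrix (N : ℕ) : Matrix (Fin (N + 1)) (Fin (N + 1)) ℝ :=
  Matrix.of fun i j => signedChoose i j

theorem dualHahnR_mul_signedChooseMatrix (N : ℕ) (γ δ : ℝ) :
    dualHahnR N γ δ * signedChooseMatrix N = signedChooseMatrix N * dualHahnT N γ δ := by
  ext n ⟨k, hk⟩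
  rw [Matrix.mul_apply, Matrix.mul_apply]
  simp only [signedChooseMatrix, dualHahnT, Matrix.of_apply]
  rw [sum_dualHahnR_mul N γ δ n fun j => signedChoose j k, mul_signedChoose_pred]
  generalize (n : ℕ) = n
  rcases k with _ | k
  · rw [Finset.sum_eq_zero, signedChoose_succ_zero]
    · push_cast
      ring
    · rintro ⟨j, hj⟩ -
      rcases j with _ | j <;> simp
  · have hsplit : ∀ j : Fin (N + 1), (signedChoose n j *
        if (j : ℕ) = k + 1 then ((k + 1 : ℕ) : ℝ) * ((k + 1 : ℕ) + γ + δ + 1)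
        else if (j : ℕ) + 1 = k + 1 then -((N - (j : ℕ)) * (γ + (j : ℕ) + 1)) else 0) =
        (if (j : ℕ) = k + 1 then
          signedChoose n (k + 1) * ((k + 1 : ℕ) * ((k + 1 : ℕ) + γ + δ + 1)) else 0) +
        (if (j : ℕ) = k then signedChoose n k * -((N - k) * (γ + k + 1)) else 0) := by
      rintro ⟨j, hj⟩
      by_cases h : j = k + 1
      · subst h
        simp
      · by_cases h' : j = k
        · subst h'
          simp
        · simp [h, h']
    rw [Finset.sum_congr rfl fun j _ => hsplit j, Finset.sum_add_distrib,
      Fin.sum_univ_eq_sum_range (fun j => if j = k + 1 then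
        signedChoose n (k + 1) * (((k + 1 : ℕ) : ℝ) * ((k + 1 : ℕ) + γ + δ + 1)) else 0),
      Fin.sum_univ_eq_sum_range (fun j => if j = k then
        signedChoose n k * -(((N : ℝ) - k) * (γ + k + 1)) else 0),
      Finset.sum_ite_eq', Finset.sum_ite_eq', if_pos (Finset.mem_range.2 hk),
      if_pos (Finset.mem_range.2 (by omega)), signedChoose_succ_succ]
    have h := signedChoose_succ_right n k
    push_cast
    linear_combination (N - n - k - γ - 1 : ℝ) * h

theorem det_signedChooseMatrix_ne_zero (N : ℕ) : (signedChooseMatrix N).det ≠ 0 := by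
  rw [Matrix.det_of_isLowerTriangular]
  · simp [signedChooseMatrix, signedChoose, Finset.prod_ne_zero_iff]
  · intro i j hij
    have : (i : ℕ) < j := hij
    simp [signedChooseMatrix, signedChoose, Nat.choose_eq_zero_of_lt this]

theorem det_smul_one_add_dualHahnR (N : ℕ) (γ δ c : ℝ) :
    (c • (1 : Matrix (Fin (N + 1)) (Fin (N + 1)) ℝ) + dualHahnR N γ δ).det =
      ∏ n ∈ Finset.range (N + 1), (c + n * (n + γ + δ + 1)) := by
  have hmul : (c • (1 : Matrix (Fin (N + 1)) (Fin (N + 1)) ℝ) + dualHahnR N γ δ) *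
      signedChooseMatrix N = signedChooseMatrix N *
      (c • (1 : Matrix (Fin (N + 1)) (Fin (N + 1)) ℝ) + dualHahnT N γ δ) := by
    rw [add_mul, mul_add, dualHahnR_mul_signedChooseMatrix]
    simp
  have hdet := congrArg Matrix.det hmul
  rw [Matrix.det_mul, Matrix.det_mul, mul_comm] at hdet
  rw [mul_left_cancel₀ (det_signedChooseMatrix_ne_zero N) hdet, Matrix.det_of_isUpperTriangular,
    ← Fin.prod_univ_eq_prod_range (fun n => c + (n : ℝ) * (n + γ + δ + 1))]
  · simp [dualHahnT]
  · intro i j hij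
    have hlt : (j : ℕ) < i := hij
    have hne : i ≠ j := ne_of_gt hij
    simp [dualHahnT, Matrix.one_apply_ne hne, hlt.ne', show (i : ℕ) + 1 ≠ j by omega]

theorem dualHahn_det (N : ℕ) (γ δ : ℝ) (x : ℝ) :
    ((-x * (x + γ + δ + 1)) • (1 : Matrix (Fin (N + 1)) (Fin (N + 1)) ℝ) +
        dualHahnR N γ δ).det =
      ∏ n ∈ Finset.range (N + 1),
        ((-x * (x + γ + δ + 1)) - (-(n : ℝ) * ((n : ℝ) + γ + δ + 1))) ∧
    ((-x * (x + γ + δ + 1)) • (1 : Matrix (Fin (N + 1)) (Fin (N + 1)) ℝ) +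
        dualHahnR N γ δ).det =
      ∏ n ∈ Finset.range (N + 1), (((n : ℝ) - x) * (x + (n : ℝ) + γ + δ + 1)) := by
  rw [det_smul_one_add_dualHahnR]
  constructor <;> refine Finset.prod_congr rfl fun n _ => ?_ <;> ring
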